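/- arXiv:1008.4966 — 5 statements merged into one kernel-verified Lean document; each statement's English description precedes it below -/
import Mathlib

section
/- (Forward direction of Lemma 1.) Let f be a maximum preflow, i.e., a preflow whose value (total excess accumulated at the sinks) is at least that of every other preflow for the same network, sources and sinks. Then there is no residual path (with respect to f) from any source to any sink, and no residual path from any vertex with strictly positive excess to any sink. -/
open Finset

variable {V : Type*}

/-- The excess (inflow minus outflow) of a vertex. -/
noncomputable def excess [Fintype V] (f : V → V → ℝ) (v : V) : ℝ :=
  (∑ u, f u v) - (∑ w, f v w)

/-- Residual capacity of the arc `(u, v)`. -/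
def Residual (c f : V → V → ℝ) (u v : V) : ℝ :=
  (c u v - f u v) + f v u

/-- Residual path: a chain of residual arcs. -/
def ResPath (c f : V → V → ℝ) : V → V → Prop :=
  Relation.ReflTransGen (fun a b => 0 < Residual c f a b)

/-- Capacity feasibility: `0 ≤ f ≤ c` on every arc. -/
def Feasible (c f : V → V → ℝ) : Prop :=
  ∀ u v, 0 ≤ f u v ∧ f u v ≤ c u v

/-- A preflow: capacity-feasible with nonnegative excess outside the sources. -/
def IsPreflow [Fintype V] (c f : V → V → ℝ) (S : Finset V) : Prop :=
  Feasible c f ∧ ∀ v, v ∉ S → 0 ≤ excess f v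

/-- A flow: capacity-feasible with zero excess outside sources and sinks. -/
def IsFlow [Fintype V] (c f : V → V → ℝ) (S T : Finset V) : Prop :=
  Feasible c f ∧ ∀ v, v ∉ S → v ∉ T → excess f v = 0

/-- The value of a (pre)flow: total excess at the sinks. -/
noncomputable def flowValue [Fintype V] (f : V → V → ℝ) (T : Finset V) : ℝ :=
  ∑ t ∈ T, excess f t

theorem excess_comb [Fintype V] (f g : V → V → ℝ) (a b : ℝ) (w : V) :
    excess (fun x y => a * f x y + b * g x y) w = a * excess f w + b * excess g w := by
  simp only [excess, Finset.sum_add_distrib, ← Finset.mul_sum]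
  ring

theorem feasible_comb (c f g : V → V → ℝ) (a b : ℝ) (ha : 0 ≤ a) (hb : 0 ≤ b) (hab : a + b = 1)
    (hf : Feasible c f) (hg : Feasible c g) :
    Feasible c (fun x y => a * f x y + b * g x y) := by
  intro x y
  obtain ⟨h1, h2⟩ := hf x y
  obtain ⟨h3, h4⟩ := hg x y
  refine ⟨by positivity, ?_⟩
  have h5 := mul_le_mul_of_nonneg_left h2 ha
  have h6 := mul_le_mul_of_nonneg_left h4 hb
  have h7 : a * c x y + b * c x y = c x y := by rw [← add_mul, hab, one_mul]
  simp only
  linarith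

open Classical in
theorem excess_unit [Fintype V] (u v w : V) :
    excess (fun a b => (if a = u then (1 : ℝ) else 0) * (if b = v then 1 else 0)) w =
      (if w = v then 1 else 0) - (if w = u then 1 else 0) := by
  simp only [excess, ← Finset.mul_sum, ← Finset.sum_mul]
  simp

open Classical in
/-- One can push a positive amount from `u` to `v`. -/
def CanPush [Fintype V] (c f : V → V → ℝ) (u v : V) : Prop :=
  ∃ g : V → V → ℝ, ∃ ε : ℝ, 0 < ε ∧ Feasible c g ∧ ∀ w, excess g w = excess f w +
    ε * ((if w = v then 1 else 0) - (if w = u then 1 else 0))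

theorem canPush_arc [Fintype V] (c f : V → V → ℝ) (hf : Feasible c f) (u v : V)
    (h : 0 < Residual c f u v) : CanPush c f u v := by
  classical
  by_cases h1 : 0 < c u v - f u v
  · refine ⟨fun x y => 1 * f x y + (c u v - f u v) *
      ((if x = u then (1 : ℝ) else 0) * (if y = v then 1 else 0)), _, h1, ?_, ?_⟩
    · intro x y
      have := hf x y
      by_cases hx : x = u <;> by_cases hy : y = v <;> simp [hx, hy] <;> grind
    · intro w
      rw [excess_comb, excess_unit]
      simp
  · have h2 : 0 < f v u := by unfold Residual at h; linarith
    refine ⟨fun x y => 1 * f x y + (- f v u) *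
      ((if x = v then (1 : ℝ) else 0) * (if y = u then 1 else 0)), _, h2, ?_, ?_⟩
    · intro x y
      have := hf x y
      by_cases hx : x = v <;> by_cases hy : y = u <;> simp [hx, hy] <;> grind
    · intro w
      rw [excess_comb, excess_unit]
      ring

theorem canPush_trans [Fintype V] (c f : V → V → ℝ) (u v w : V)
    (h1 : CanPush c f u v) (h2 : CanPush c f v w) : CanPush c f u w := by
  obtain ⟨g, ε, hε, hg, hge⟩ := h1
  obtain ⟨k, δ, hδ, hk, hke⟩ := h2
  refine ⟨fun x y => (δ / (ε + δ)) * g x y + (ε / (ε + δ)) * k x y, ε * δ / (ε + δ),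
    by positivity, feasible_comb c g k _ _ (by positivity) (by positivity) (by field_simp; ring)
      hg hk, ?_⟩
  intro x
  rw [excess_comb, hge, hke]
  field_simp
  ring

theorem canPush_path [Fintype V] (c f : V → V → ℝ) (hf : Feasible c f) (u v : V)
    (h : ResPath c f u v) : CanPush c f u v := by
  unfold ResPath at h
  induction h with
  | refl => exact ⟨f, 1, one_pos, hf, fun w => by ring⟩
  | tail _ h ih => exact canPush_trans c f _ _ _ ih (canPush_arc c f hf _ _ h)

theorem no_path_aux [Fintype V]
    (c : V → V → ℝ) (S T : Finset V) (f : V → V → ℝ) (hf : IsPreflow c f S)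
    (hmax : ∀ g : V → V → ℝ, IsPreflow c g S → flowValue g T ≤ flowValue f T)
    (u t : V) (hu : u ∉ T) (ht : t ∈ T) (hue : u ∉ S → 0 < excess f u) :
    ¬ ResPath c f u t := by
  classical
  intro hp
  obtain ⟨g, ε, hε, hg, hge⟩ := canPush_path c f hf.1 u t hp
  obtain ⟨l, hl0, hl1, hl⟩ : ∃ l : ℝ, 0 < l ∧ l ≤ 1 ∧ (u ∉ S → l * ε ≤ excess f u) := by
    by_cases hS : u ∈ S
    · exact ⟨1, one_pos, le_rfl, fun h => absurd hS h⟩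
    · have := hue hS
      refine ⟨min 1 (excess f u / ε), lt_min one_pos (by positivity), min_le_left _ _, fun _ => ?_⟩
      rw [← le_div_iff₀ hε]
      exact min_le_right _ _
  have hex : ∀ w, excess (fun x y => (1 - l) * f x y + l * g x y) w = excess f w +
      l * ε * ((if w = t then 1 else 0) - (if w = u then 1 else 0)) := by
    intro w
    rw [excess_comb, hge]
    ring
  have hle : 0 < l * ε := by positivity
  have := hmax (fun x y => (1 - l) * f x y + l * g x y)
    ⟨feasible_comb c f g _ _ (by linarith) hl0.le (by ring) hf.1 hg, by
      intro w hw
      rw [hex]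
      have := hf.2 w hw
      by_cases h1 : w = u
      · subst h1
        have := hl hw
        split_ifs <;> linarith
      · split_ifs <;> linarith⟩
  unfold flowValue at this
  simp only [hex, Finset.sum_add_distrib, ← Finset.mul_sum, Finset.sum_sub_distrib,
    Finset.sum_ite_eq', ht, hu, if_true, if_false] at this
  linarith

/-- Forward direction of Lemma 1: a maximum preflow admits no residual path
from a source to a sink, and none from a vertex with strictly positive excess
to a sink. -/
theorem maxPreflow_no_residual_path [Fintype V]
    (c : V → V → ℝ) (hc : ∀ u v, 0 ≤ c u v)
    (S T : Finset V) (hST : Disjoint S T)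
    (f : V → V → ℝ) (hf : IsPreflow c f S)
    (hmax : ∀ g : V → V → ℝ, IsPreflow c g S → flowValue g T ≤ flowValue f T) :
    (∀ s ∈ S, ∀ t ∈ T, ¬ ResPath c f s t) ∧
    (∀ v : V, v ∉ S → v ∉ T → 0 < excess f v → ∀ t ∈ T, ¬ ResPath c f v t) := by
  exact ⟨fun s hs t ht => no_path_aux c S T f hf hmax s t (Finset.disjoint_left.mp hST hs) ht
      (fun h => absurd hs h),
    fun v _ hvT hv t ht => no_path_aux c S T f hf hmax v t hvT ht (fun _ => hv)⟩
end

section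
/- (Reverse direction of Lemma 1.) Let f be a preflow such that there is no residual path from any source to any sink and no residual path from any vertex with strictly positive excess to any sink. Then f is a maximum preflow, i.e., its value is at least the value of every preflow for the same network, sources and sinks. -/
open Finset

variable {V : Type*}

theorem sum_excess_cut [Fintype V] [DecidableEq V] (h : V → V → ℝ) (B : Finset V) :
    ∑ v ∈ B, excess h v = ∑ v ∈ B, ∑ u ∈ Bᶜ, (h u v - h v u) := by
  have h1 : ∀ v, excess h v = ∑ u ∈ B, h u v - ∑ u ∈ B, h v u + ∑ u ∈ Bᶜ, (h u v - h v u) := by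
    intro v
    unfold excess
    rw [← Finset.sum_add_sum_compl B (fun u => h u v), ← Finset.sum_add_sum_compl B (fun u => h v u),
      Finset.sum_sub_distrib]
    ring
  simp_rw [h1]
  rw [Finset.sum_add_distrib, Finset.sum_sub_distrib, Finset.sum_comm (s := B) (t := B)]
  simp

/-- Reverse direction of Lemma 1: a preflow with no residual path from any
source or excess vertex to any sink is a maximum preflow. -/
theorem no_residual_path_maxPreflow [Fintype V]
    (c : V → V → ℝ) (hc : ∀ u v, 0 ≤ c u v)
    (S T : Finset V) (hST : Disjoint S T)
    (f : V → V → ℝ) (hf : IsPreflow c f S)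
    (hsrc : ∀ s ∈ S, ∀ t ∈ T, ¬ ResPath c f s t)
    (hexc : ∀ v : V, v ∉ S → v ∉ T → 0 < excess f v → ∀ t ∈ T, ¬ ResPath c f v t) :
    ∀ g : V → V → ℝ, IsPreflow c g S → flowValue g T ≤ flowValue f T := by
  classical
  intro g hg
  set B : Finset V := Finset.univ.filter (fun v => ∃ t ∈ T, ResPath c f v t) with hB
  have hmem : ∀ v, v ∈ B ↔ ∃ t ∈ T, ResPath c f v t := by intro v; simp [hB]
  have hTB : T ⊆ B := fun t ht => (hmem t).2 ⟨t, ht, Relation.ReflTransGen.refl⟩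
  have hBS : ∀ v ∈ B, v ∉ S := by
    intro v hv hs
    obtain ⟨t, ht, hp⟩ := (hmem v).1 hv
    exact hsrc v hs t ht hp
  have hfv : flowValue f T = ∑ v ∈ B, excess f v := by
    refine Finset.sum_subset hTB fun v hv hvT => ?_
    obtain ⟨t, ht, hp⟩ := (hmem v).1 hv
    refine le_antisymm (not_lt.1 fun hlt => ?_) (hf.2 v (hBS v hv))
    exact hexc v (hBS v hv) hvT hlt t ht hp
  have hgv : flowValue g T ≤ ∑ v ∈ B, excess g v :=
    Finset.sum_le_sum_of_subset_of_nonneg hTB fun v hv _ => hg.2 v (hBS v hv)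
  rw [hfv]
  refine hgv.trans ?_
  rw [sum_excess_cut, sum_excess_cut]
  refine Finset.sum_le_sum fun v hv => Finset.sum_le_sum fun u hu => ?_
  have hr : Residual c f u v ≤ 0 := by
    refine not_lt.1 fun hlt => (Finset.mem_compl.1 hu) ?_
    obtain ⟨t, ht, hp⟩ := (hmem v).1 hv
    exact (hmem u).2 ⟨t, ht, Relation.ReflTransGen.head hlt hp⟩
  unfold Residual at hr
  have a1 := hf.1 u v
  have a2 := hf.1 v u
  have a3 := hg.1 u v
  have a4 := hg.1 v u
  linarith [a1.1, a1.2, a2.1, a2.2, a3.1, a3.2, a4.1, a4.2]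
end

section
/- (Outer-loop invariant in the proof of Theorem 1.) Let f be a flow and let s ∈ S be a source such that f admits no residual path from s to any sink. Let f' be a flow that agrees with f on every ordered pair (u,v) except possibly on pairs (u,v) where both u and v lie on some fixed residual path (with respect to f) from another vertex x to a sink t (as happens when augmenting f along a residual x-to-t path). Then f' also admits no residual path from s to any sink. -/
open Finset

variable {V : Type*}

theorem mem_chain_reach {V : Type*} (r : V → V → Prop) (t : V) :
    ∀ p : List V, List.IsChain r p → p.getLast? = some t →
      ∀ a ∈ p, Relation.ReflTransGen r a t := by
  intro p
  induction p with
  | nil => intro _ _ a ha; simp at ha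
  | cons y q ih =>
    intro hch hl a ha
    cases q with
    | nil =>
      simp at hl ha
      subst hl ha
      exact Relation.ReflTransGen.refl
    | cons z q =>
      rw [List.isChain_cons_cons] at hch
      rw [List.getLast?_cons_cons] at hl
      rcases List.mem_cons.1 ha with h | h
      · subst h
        exact Relation.ReflTransGen.head hch.1 (ih hch.2 hl z (by simp))
      · exact ih hch.2 hl a h

/-- Outer-loop invariant of Theorem 1: augmenting along a residual path from
some vertex x to a sink (changing the flow only on pairs of vertices lying on
that path) cannot create a residual path from a fully-saturated source s to
any sink. -/
theorem outer_loop_invariant [Fintype V]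
    (c : V → V → ℝ) (hc : ∀ u v, 0 ≤ c u v)
    (S T : Finset V) (hST : Disjoint S T)
    (f f' : V → V → ℝ) (hf : IsFlow c f S T) (hf' : IsFlow c f' S T)
    (s : V) (hs : s ∈ S)
    (hnores : ∀ t ∈ T, ¬ ResPath c f s t)
    (x t : V) (ht : t ∈ T) (p : List V)
    (hchain : List.Chain' (fun a b => 0 < Residual c f a b) p)
    (hhead : p.head? = some x) (hlast : p.getLast? = some t)
    (hagree : ∀ u v : V, f' u v ≠ f u v → u ∈ p ∧ v ∈ p) :
    ∀ t' ∈ T, ¬ ResPath c f' s t' := by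
  intro t' ht' hp
  have hnot : ∀ a, ResPath c f s a → a ∉ p := fun a ha hap =>
    hnores t ht (Relation.ReflTransGen.trans ha (mem_chain_reach _ t p hchain hlast a hap))
  have key : ∀ b, ResPath c f' s b → ResPath c f s b := by
    intro b hb
    induction hb with
    | refl => exact Relation.ReflTransGen.refl
    | @tail a b _ hab ih =>
      refine Relation.ReflTransGen.tail ih ?_
      have h1 : f' a b = f a b := by
        by_contra h
        exact hnot a ih (hagree _ _ h).1
      have h2 : f' b a = f b a := by
        by_contra h
        exact hnot a ih (hagree _ _ h).2
      simpa only [Residual, h1, h2] using hab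
  exact hnores t' ht' (key t' hp)
end

section
/- (Theorem 1: source-major greedy saturation yields a maximum flow.) Enumerate the sources as s₁, …, s_k (in any order, each once) and, for each source, the sinks as t₁, …, t_m (in any order, each once); let (p₁, …, p_{km}) be the resulting list of source-sink pairs in source-major order (all pairs with source s₁ first, then all pairs with source s₂, etc.). Let f₀ be the zero flow, and for each i let f_i be a flow such that: (a) f_i agrees in excess with f_{i−1} at every vertex other than the source and sink of pair p_i, with the excess at the source of p_i only decreasing and the excess at the sink of p_i only increasing; (b) f_i admits no residual path from the source of p_i to the sink of p_i (i.e., f_i is obtained from f_{i−1} by saturating a maximum flow between this pair in the residual graph). Then the final flow f_{km} is a maximum flow from S to T: its value ∑_{t ∈ T} ex_{f_{km}}(t) is at least the value of every flow, and f_{km} admits no residual path from any source to any sink. -/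
open Finset

variable {V : Type*}

/-- No residual arc leaves `A`. -/
def ResClosed (c f : V → V → ℝ) (A : Finset V) : Prop :=
  ∀ u ∈ A, ∀ v, v ∉ A → Residual c f u v ≤ 0

open Classical in
lemma sum_excess_eq [Fintype V] (f : V → V → ℝ) (A : Finset V) :
    ∑ v ∈ A, excess f v = ∑ u ∈ A, ∑ v ∈ Aᶜ, (f v u - f u v) := by
  have h : ∑ u ∈ A, ∑ v ∈ A, f v u = ∑ u ∈ A, ∑ v ∈ A, f u v := Finset.sum_comm
  have e : ∀ v, excess f v = (∑ w ∈ A, f w v - ∑ w ∈ A, f v w)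
      + ∑ w ∈ Aᶜ, (f w v - f v w) := by
    intro v
    unfold excess
    rw [← Finset.sum_add_sum_compl A (fun u => f u v),
      ← Finset.sum_add_sum_compl A (fun u => f v u), Finset.sum_sub_distrib]
    ring
  simp only [e]
  rw [Finset.sum_add_distrib, Finset.sum_sub_distrib, h]
  ring

open Classical in
lemma sum_excess_univ [Fintype V] (f : V → V → ℝ) (A : Finset V) :
    ∑ v ∈ A, excess f v = - ∑ v ∈ Aᶜ, excess f v := by
  have h := sum_excess_eq f Finset.univ
  simp only [Finset.compl_univ, Finset.sum_empty, Finset.sum_const_zero] at h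
  rw [← Finset.sum_add_sum_compl A] at h
  linarith

lemma closed_le [Fintype V] {c f g : V → V → ℝ} {A : Finset V}
    (hA : ResClosed c f A) (hf : Feasible c f) (hg : Feasible c g) :
    ∑ v ∈ A, excess f v ≤ ∑ v ∈ A, excess g v := by
  classical
  rw [sum_excess_eq, sum_excess_eq]
  refine Finset.sum_le_sum fun u hu => Finset.sum_le_sum fun v hv => ?_
  have h1 := hA u hu v (by simpa using hv)
  unfold Residual at h1
  linarith [(hf u v).2, (hf v u).1, (hg u v).2, (hg v u).1]

lemma closed_of_le [Fintype V] {c f g : V → V → ℝ} {A : Finset V}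
    (hA : ResClosed c f A) (hf : Feasible c f) (hg : Feasible c g)
    (hle : ∑ v ∈ A, excess g v ≤ ∑ v ∈ A, excess f v) : ResClosed c g A := by
  classical
  have heq := le_antisymm (closed_le hA hf hg) hle
  rw [sum_excess_eq, sum_excess_eq] at heq
  have hp : ∀ u ∈ A, ∀ v ∈ Aᶜ, f v u - f u v ≤ g v u - g u v := by
    intro u hu v hv
    have h1 := hA u hu v (by simpa using hv)
    unfold Residual at h1
    linarith [(hf u v).2, (hf v u).1, (hg u v).2, (hg v u).1]
  have h2 := (Finset.sum_eq_sum_iff_of_le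
    (fun u hu => Finset.sum_le_sum (hp u hu))).1 heq
  intro u hu v hv
  have h3 := (Finset.sum_eq_sum_iff_of_le (hp u hu)).1 (h2 u hu) v (by simpa using hv)
  have h1 := hA u hu v hv
  unfold Residual at *
  linarith [(hf u v).2, (hf v u).1, (hg u v).2, (hg v u).1]

lemma ResClosed.mem {c f : V → V → ℝ} {A : Finset V} (hA : ResClosed c f A) {s t : V}
    (h : ResPath c f s t) (hs : s ∈ A) : t ∈ A := by
  induction h with
  | refl => exact hs
  | tail _ h ih =>
    by_contra hn
    exact absurd h (not_lt.2 (hA _ ih _ hn))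

open Classical in
/-- Vertices reachable from a set. -/
noncomputable def reachSet [Fintype V] (c f : V → V → ℝ) (S : Finset V) : Finset V :=
  Finset.univ.filter fun v => ∃ s ∈ S, ResPath c f s v

lemma mem_reachSet [Fintype V] {c f : V → V → ℝ} {S : Finset V} {v : V} :
    v ∈ reachSet c f S ↔ ∃ s ∈ S, ResPath c f s v := by
  simp [reachSet]

lemma reachSet_closed [Fintype V] (c f : V → V → ℝ) (S : Finset V) :
    ResClosed c f (reachSet c f S) := by
  intro u hu v hv
  rw [mem_reachSet] at hu hv
  by_contra h
  obtain ⟨s, hs, hp⟩ := hu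
  exact hv ⟨s, hs, Relation.ReflTransGen.tail hp (not_le.1 h)⟩

/-- One saturation step. -/
def SatStep [Fintype V] (c f : V → V → ℝ) (p : V × V) (g : V → V → ℝ) : Prop :=
  Feasible c f ∧ Feasible c g ∧
  (∀ v : V, v ≠ p.1 → v ≠ p.2 → excess g v = excess f v) ∧
  excess g p.1 ≤ excess f p.1 ∧ excess f p.2 ≤ excess g p.2 ∧ ¬ ResPath c g p.1 p.2

lemma SatStep.closed [Fintype V] {c f g : V → V → ℝ} {p : V × V} (h : SatStep c f p g)
    {A : Finset V} (hA : ResClosed c f A) (hp : p.2 ∈ A → p.1 ∈ A) : ResClosed c g A := by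
  classical
  obtain ⟨hf, hg, he, h1, h2, -⟩ := h
  refine closed_of_le hA hf hg ?_
  by_cases hs : p.1 ∈ A
  · rw [sum_excess_univ g, sum_excess_univ f]
    refine neg_le_neg (Finset.sum_le_sum fun v hv => ?_)
    by_cases hv2 : v = p.2
    · rw [hv2]; exact h2
    · refine (he v ?_ hv2).ge
      rintro rfl
      simp [hs] at hv
  · refine Finset.sum_le_sum fun v hv => (he v ?_ ?_).le
    · rintro rfl; exact hs hv
    · rintro rfl; exact hs (hp hv)

lemma SatStep.same [Fintype V] {c f g : V → V → ℝ} {s t : V} (h : SatStep c f (s, t) g)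
    {t0 : V} (hn : ¬ ResPath c f s t0) : ¬ ResPath c g s t0 := by
  intro hp
  have hs : s ∈ reachSet c f {s} :=
    mem_reachSet.2 ⟨s, by simp, Relation.ReflTransGen.refl⟩
  have := (h.closed (reachSet_closed c f {s}) (fun _ => hs)).mem hp hs
  rw [mem_reachSet] at this
  simp at this
  exact hn this

lemma SatStep.other [Fintype V] {c f g : V → V → ℝ} {p : V × V} (h : SatStep c f p g)
    {τ : List V} (hp2 : p.2 ∈ τ) {s : V} (hn : ∀ t ∈ τ, ¬ ResPath c f s t) :
    ∀ t ∈ τ, ¬ ResPath c g s t := by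
  intro t ht hp
  have hs : s ∈ reachSet c f {s} :=
    mem_reachSet.2 ⟨s, by simp, Relation.ReflTransGen.refl⟩
  have hnot : ∀ t ∈ τ, t ∉ reachSet c f {s} := by
    intro t ht hm
    rw [mem_reachSet] at hm
    simp at hm
    exact hn t ht hm
  exact hnot t ht ((h.closed (reachSet_closed c f {s}) (fun h => absurd h (hnot _ hp2))).mem hp hs)

/-- A chain of saturation steps along a list of pairs. -/
def SatChain [Fintype V] (c : V → V → ℝ) : List (V × V) → (V → V → ℝ) → (V → V → ℝ) → Prop
  | [], f, g => f = g
  | p :: L, f, g => ∃ h, SatStep c f p h ∧ SatChain c L h g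

lemma SatChain.append [Fintype V] {c : V → V → ℝ} {L M : List (V × V)} {f g : V → V → ℝ}
    (h : SatChain c (L ++ M) f g) : ∃ k, SatChain c L f k ∧ SatChain c M k g := by
  induction L generalizing f with
  | nil => exact ⟨f, rfl, h⟩
  | cons p L ih =>
    obtain ⟨k, hk, h⟩ := h
    obtain ⟨k', h1, h2⟩ := ih h
    exact ⟨k', ⟨k, hk, h1⟩, h2⟩

lemma SatChain.other [Fintype V] {c : V → V → ℝ} {L : List (V × V)} {f g : V → V → ℝ}
    (h : SatChain c L f g) {τ : List V} (hL : ∀ p ∈ L, p.2 ∈ τ) {s : V}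
    (hn : ∀ t ∈ τ, ¬ ResPath c f s t) : ∀ t ∈ τ, ¬ ResPath c g s t := by
  induction L generalizing f with
  | nil => cases h; exact hn
  | cons p L ih =>
    obtain ⟨k, hk, h⟩ := h
    exact ih h (fun q hq => hL q (by simp [hq])) (hk.other (hL p (by simp)) hn)

lemma SatChain.same [Fintype V] {c : V → V → ℝ} {τ : List V} {f g : V → V → ℝ} {s : V}
    (h : SatChain c (τ.map fun t => (s, t)) f g) :
    ∀ t, (t ∈ τ ∨ ¬ ResPath c f s t) → ¬ ResPath c g s t := by
  induction τ generalizing f with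
  | nil => cases h; simp
  | cons t0 τ ih =>
    obtain ⟨k, hk, h⟩ := h
    rintro t (ht | ht)
    · rcases List.mem_cons.1 ht with rfl | ht
      · exact ih h _ (Or.inr hk.2.2.2.2.2)
      · exact ih h _ (Or.inl ht)
    · exact ih h _ (Or.inr (hk.same ht))

lemma SatChain.all [Fintype V] {c : V → V → ℝ} {σ τ : List V} {f g : V → V → ℝ}
    (h : SatChain c (σ.flatMap fun s => τ.map fun t => (s, t)) f g) :
    ∀ s ∈ σ, ∀ t ∈ τ, ¬ ResPath c g s t := by
  induction σ generalizing f with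
  | nil => simp
  | cons s0 σ ih =>
    rw [List.flatMap_cons] at h
    obtain ⟨k, h1, h2⟩ := h.append
    intro s hs
    rcases List.mem_cons.1 hs with rfl | hs
    · refine h2.other ?_ (fun t ht => h1.same t (Or.inl ht))
      intro p hp
      simp only [List.mem_flatMap, List.mem_map] at hp
      obtain ⟨_, _, t, ht, rfl⟩ := hp
      exact ht
    · exact ih h2 s hs

lemma satChain_of_seq [Fintype V] {c : V → V → ℝ} (P : List (V × V)) (F : ℕ → V → V → ℝ)
    (h : ∀ i (hi : i < P.length), SatStep c (F i) (P.get ⟨i, hi⟩) (F (i + 1))) :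
    SatChain c P (F 0) (F P.length) := by
  induction P generalizing F with
  | nil => rfl
  | cons p P ih =>
    refine ⟨F 1, h 0 (by simp), ?_⟩
    exact ih (fun i => F (i + 1)) (fun i hi => h (i + 1) (by simpa using hi))

lemma flow_sum [Fintype V] {c g : V → V → ℝ} {S T A : Finset V} (hg : IsFlow c g S T)
    (hS : S ⊆ A) (hT : Disjoint A T) : ∑ v ∈ A, excess g v = - flowValue g T := by
  classical
  rw [sum_excess_univ, flowValue, neg_inj]
  symm
  refine Finset.sum_subset ?_ ?_
  · intro t ht
    simpa using fun h => Finset.disjoint_left.1 hT h ht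
  · intro v hv hvT
    exact hg.2 v (fun h => by simp [hS h] at hv) hvT

/-- Theorem 1: iterating over the sources in any order, and for each source
over the sinks in any order, saturating a maximum flow between the pair in the
residual graph, yields a maximum flow from S to T. -/
theorem source_major_greedy_max_flow [Fintype V]
    (c : V → V → ℝ) (hc : ∀ u v, 0 ≤ c u v)
    (S T : Finset V) (hST : Disjoint S T)
    (σ τ : List V) (hσnd : σ.Nodup) (hτnd : τ.Nodup)
    (hσS : ∀ v : V, v ∈ σ ↔ v ∈ S) (hτT : ∀ v : V, v ∈ τ ↔ v ∈ T)
    (P : List (V × V)) (hP : P = σ.flatMap (fun s => τ.map (fun t => (s, t))))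
    (F : ℕ → V → V → ℝ)
    (hF0 : F 0 = fun _ _ => 0)
    (hflow : ∀ i ≤ P.length, IsFlow c (F i) S T)
    (hstep : ∀ i : ℕ, ∀ hi : i < P.length,
      (∀ v : V, v ≠ (P.get ⟨i, hi⟩).1 → v ≠ (P.get ⟨i, hi⟩).2 →
        excess (F (i + 1)) v = excess (F i) v) ∧
      excess (F (i + 1)) (P.get ⟨i, hi⟩).1 ≤ excess (F i) (P.get ⟨i, hi⟩).1 ∧
      excess (F i) (P.get ⟨i, hi⟩).2 ≤ excess (F (i + 1)) (P.get ⟨i, hi⟩).2 ∧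
      ¬ ResPath c (F (i + 1)) (P.get ⟨i, hi⟩).1 (P.get ⟨i, hi⟩).2) :
    (∀ g : V → V → ℝ, IsFlow c g S T → flowValue g T ≤ flowValue (F P.length) T) ∧
    (∀ s ∈ S, ∀ t ∈ T, ¬ ResPath c (F P.length) s t) := by
  have hfin : ∀ s ∈ S, ∀ t ∈ T, ¬ ResPath c (F P.length) s t := by
    have hch : SatChain c P (F 0) (F P.length) := by
      refine satChain_of_seq P F fun i hi => ?_
      exact ⟨(hflow i hi.le).1, (hflow (i + 1) hi).1, hstep i hi⟩
    have key : ∀ g, SatChain c P (F 0) g → ∀ s ∈ S, ∀ t ∈ T, ¬ ResPath c g s t := by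
      intro g hg s hs t ht
      rw [hP] at hg
      exact hg.all s ((hσS s).2 hs) t ((hτT t).2 ht)
    exact key _ hch
  refine ⟨fun g hg => ?_, hfin⟩
  have hF := hflow P.length le_rfl
  have hsub : S ⊆ reachSet c (F P.length) S := fun s hs =>
    mem_reachSet.2 ⟨s, hs, Relation.ReflTransGen.refl⟩
  have hdis : Disjoint (reachSet c (F P.length) S) T := by
    rw [Finset.disjoint_left]
    intro v hv hvT
    obtain ⟨s, hs, hp⟩ := mem_reachSet.1 hv
    exact hfin s hs v hvT hp
  have h := closed_le (reachSet_closed c (F P.length) S) hF.1 hg.1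
  rw [flow_sum hF hsub hdis, flow_sum hg hsub hdis] at h
  linarith
end

section
/- (Preflow-to-flow conversion, used for Phase 3.) For every preflow g there exists a flow f such that f u v ≤ g u v for all u, v and such that ex_f(t) = ex_g(t) for every sink t ∈ T (the flow into the sinks is preserved). Consequently, the maximum value over all preflows equals the maximum value over all flows, and every maximum preflow can be converted into a maximum flow without changing the value. -/
open Finset

variable {V : Type*}

/-- Along a walk of positive arcs from `a` to `b` there is a unit walk flow supported on them. -/
theorem walk_unit [Fintype V] [DecidableEq V] (f : V → V → ℝ) (a b : V)
    (h : Relation.ReflTransGen (fun u v => 0 < f u v) a b) :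
    ∃ d : V → V → ℝ, (∀ u v, 0 ≤ d u v) ∧ (∀ u v, 0 < d u v → 0 < f u v) ∧
      ∀ v, excess d v = (if v = b then 1 else 0) - (if v = a then 1 else 0) := by
  induction h with
  | refl => exact ⟨fun _ _ => 0, by simp, by simp, by simp [excess]⟩
  | @tail p q _ hpq ih =>
    obtain ⟨d, h0, h1, h2⟩ := ih
    refine ⟨fun u v => d u v + (if u = p then (if v = q then 1 else 0) else 0), ?_, ?_, ?_⟩
    · intro u v
      have := h0 u v
      dsimp only
      split_ifs <;> linarith
    · intro u v huv
      by_cases hu : u = p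
      · by_cases hv : v = q
        · subst hu; subst hv; exact hpq
        · apply h1; simpa [hu, hv] using huv
      · apply h1; simpa [hu] using huv
    · intro v
      have := h2 v
      unfold excess at this ⊢
      simp only [Finset.sum_add_distrib]
      have e1 : ∑ u, (if u = p then (if v = q then (1:ℝ) else 0) else 0)
          = if v = q then 1 else 0 := by simp
      have e2 : ∑ w, (if v = p then (if w = q then (1:ℝ) else 0) else 0)
          = if v = p then 1 else 0 := by by_cases hv : v = p <;> simp [hv]
      rw [e1, e2]
      linarith

/-- A small positive multiple of `d` fits below `f`. -/
theorem small_multiple [Fintype V] (f d : V → V → ℝ) (hf : ∀ u v, 0 ≤ f u v)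
    (hd : ∀ u v, 0 ≤ d u v) (hs : ∀ u v, 0 < d u v → 0 < f u v) (δ : ℝ) (hδ : 0 < δ) :
    ∃ ε, 0 < ε ∧ ε ≤ δ ∧ ∀ u v, ε * d u v ≤ f u v := by
  have key : ∀ p : V × V, ∀ᶠ ε in nhdsWithin (0:ℝ) (Set.Ioi 0), ε * d p.1 p.2 ≤ f p.1 p.2 := by
    intro p
    rcases (hd p.1 p.2).eq_or_lt with h | h
    · exact Filter.Eventually.of_forall fun ε => by rw [← h]; simpa using hf _ _
    · have hq : 0 < f p.1 p.2 / d p.1 p.2 := div_pos (hs _ _ h) h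
      filter_upwards [Ioc_mem_nhdsGT hq] with ε hε
      exact (le_div_iff₀ h).1 hε.2
  have h2 := (Filter.eventually_all.2 key).and (Ioc_mem_nhdsGT hδ)
  obtain ⟨ε, h3, h4⟩ := h2.exists
  exact ⟨ε, h4.1, h4.2, fun u v => h3 (u, v)⟩

theorem excess_continuous [Fintype V] :
    Continuous (fun f : V → V → ℝ => (excess f : V → ℝ)) := by
  unfold excess
  fun_prop

/-- Minimal element below `g` whose excess vector stays in a closed set. -/
theorem exists_reduced [Fintype V] [DecidableEq V] (g : V → V → ℝ) (hg : ∀ u v, 0 ≤ g u v)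
    (P : Set (V → ℝ)) (hP : IsClosed P) (hgP : excess g ∈ P) :
    ∃ f : V → V → ℝ, (∀ u v, 0 ≤ f u v) ∧ (∀ u v, f u v ≤ g u v) ∧ excess f ∈ P ∧
      ∀ a b, a ≠ b → Relation.ReflTransGen (fun u v => 0 < f u v) a b → ∀ δ > 0,
        ¬ ∀ ε, 0 < ε → ε ≤ δ →
          (fun v => excess f v + ε * ((if v = a then 1 else 0) - (if v = b then 1 else 0))) ∈ P := by
  have hK : IsCompact (Set.Icc (0 : V → V → ℝ) g ∩ (fun f => (excess f : V → ℝ)) ⁻¹' P) :=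
    isCompact_Icc.inter_right (hP.preimage excess_continuous)
  obtain ⟨f, ⟨⟨hf0, hfg⟩, hfP⟩, hmin⟩ := hK.exists_isMinOn
    (f := fun f : V → V → ℝ => ∑ u, ∑ v, f u v) ⟨g, ⟨hg, le_refl g⟩, hgP⟩
    (by fun_prop)
  refine ⟨f, hf0, hfg, hfP, ?_⟩
  intro a b hab hpath δ hδ hall
  obtain ⟨d, hd0, hds, hde⟩ := walk_unit f a b hpath
  obtain ⟨ε, hε, hεδ, hle⟩ := small_multiple f d hf0 hd0 hds δ hδ
  have hex : (excess (fun u v => f u v - ε * d u v) : V → ℝ) =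
      fun v => excess f v + ε * ((if v = a then 1 else 0) - (if v = b then 1 else 0)) := by
    funext v
    have h1 := hde v
    have h2 : excess (fun u v => f u v - ε * d u v) v = excess f v - ε * excess d v := by
      unfold excess
      simp only [Finset.sum_sub_distrib, ← Finset.mul_sum]
      ring
    rw [h2, h1]; ring
  have hmem : (fun u v => f u v - ε * d u v) ∈
      (Set.Icc (0 : V → V → ℝ) g ∩ (fun f => (excess f : V → ℝ)) ⁻¹' P) := by
    refine ⟨⟨fun u v => ?_, fun u v => ?_⟩, ?_⟩
    · have := hle u v
      simp only [Pi.zero_apply]; linarith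
    · have h1 := hfg u v
      have h2 := mul_nonneg hε.le (hd0 u v)
      simp only; linarith
    · simp only [Set.mem_preimage]; rw [hex]; exact hall ε hε hεδ
  have hm : ∑ u, ∑ v, f u v ≤ ∑ u, ∑ v, (f u v - ε * d u v) := hmin hmem
  simp only [Finset.sum_sub_distrib, ← Finset.mul_sum] at hm
  have hsum : ∑ u, ∑ v, d u v ≤ 0 := by
    by_contra hc
    push Not at hc
    have := mul_pos hε hc
    linarith
  have hz : ∀ u v, d u v = 0 := by
    intro u v
    have h1 : d u v ≤ ∑ w, d u w :=
      Finset.single_le_sum (fun w _ => hd0 u w) (Finset.mem_univ v)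
    have h2 : ∑ w, d u w ≤ ∑ x, ∑ w, d x w :=
      Finset.single_le_sum (f := fun x => ∑ w, d x w)
        (fun x _ => Finset.sum_nonneg fun w _ => hd0 x w) (Finset.mem_univ u)
    linarith [hd0 u v]
  have := hde b
  simp [excess, hz, hab.symm] at this

/-- From a vertex of negative excess one reaches a vertex of positive excess. -/
theorem reach_pos [Fintype V] (f : V → V → ℝ) (hf : ∀ u v, 0 ≤ f u v) (t : V)
    (ht : excess f t < 0) :
    ∃ x, Relation.ReflTransGen (fun u v => 0 < f u v) t x ∧ 0 < excess f x := by
  classical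
  by_contra hcon
  push Not at hcon
  let R : Finset V := Finset.univ.filter
    fun x => Relation.ReflTransGen (fun u v => 0 < f u v) t x
  have hout : ∀ u ∈ R, ∑ w, f u w = ∑ w ∈ R, f u w := by
    intro u hu
    symm
    apply Finset.sum_subset (Finset.subset_univ _)
    intro w _ hw
    by_contra hne
    apply hw
    have hpos : 0 < f u w := lt_of_le_of_ne (hf u w) (Ne.symm hne)
    simp only [R, Finset.mem_filter, Finset.mem_univ, true_and] at hu ⊢
    exact hu.tail hpos
  have hin : ∀ v ∈ R, ∑ u ∈ R, f u v ≤ ∑ u, f u v := fun v _ =>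
    Finset.sum_le_sum_of_subset_of_nonneg (Finset.subset_univ _) fun u _ _ => hf u v
  have hnn : 0 ≤ ∑ v ∈ R, excess f v := by
    unfold excess
    rw [Finset.sum_sub_distrib, Finset.sum_congr rfl hout, Finset.sum_comm (s := R) (t := R)]
    have := Finset.sum_le_sum hin
    linarith
  have hneg : ∑ v ∈ R, excess f v < 0 := by
    apply Finset.sum_neg' 
    · intro v hv
      exact hcon v (by simpa [R] using hv)
    · exact ⟨t, by simp [R, Relation.ReflTransGen.refl], ht⟩
  linarith

/-- A vertex of positive excess is reached from a vertex of negative excess. -/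
theorem reach_neg [Fintype V] (f : V → V → ℝ) (hf : ∀ u v, 0 ≤ f u v) (t : V)
    (ht : 0 < excess f t) :
    ∃ x, Relation.ReflTransGen (fun u v => 0 < f u v) x t ∧ excess f x < 0 := by
  have hrev : ∀ v, excess (fun u v => f v u) v = - excess f v := by
    intro v; unfold excess; ring
  obtain ⟨x, hx, hp⟩ := reach_pos (fun u v => f v u) (fun u v => hf v u) t
    (by rw [hrev]; linarith)
  refine ⟨x, ?_, by rw [hrev] at hp; linarith⟩
  exact Relation.reflTransGen_swap.1 hx

/-- Any flow is dominated in value by a preflow. -/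
theorem flow_dominated [Fintype V] (c : V → V → ℝ) (S T : Finset V) (hST : Disjoint S T)
    (f' : V → V → ℝ) (hf : IsFlow c f' S T) :
    ∃ h : V → V → ℝ, IsPreflow c h S ∧ flowValue f' T ≤ flowValue h T := by
  classical
  obtain ⟨h, h0, hle, hP, hred⟩ := exists_reduced f' (fun u v => (hf.1 u v).1)
    {e | (∀ v, v ∉ S → v ∉ T → e v = 0) ∧ flowValue f' T ≤ ∑ t ∈ T, e t}
    (by
      apply IsClosed.and
      · simp only [Set.setOf_forall]
        exact isClosed_iInter fun v => isClosed_iInter fun _ => isClosed_iInter fun _ =>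
          isClosed_eq (continuous_apply v) continuous_const
      · exact isClosed_le continuous_const (by fun_prop))
    ⟨hf.2, le_refl _⟩
  refine ⟨h, ⟨fun u v => ⟨h0 u v, (hle u v).trans (hf.1 u v).2⟩, ?_⟩, hP.2⟩
  intro t htS
  by_cases htT : t ∈ T
  swap
  · exact (hP.1 t htS htT).ge
  by_contra hneg
  push Not at hneg
  obtain ⟨x, hx, hpos⟩ := reach_pos h h0 t hneg
  have hne : t ≠ x := by rintro rfl; linarith
  refine hred t x hne hx 1 one_pos fun ε hε _ => ⟨fun v hvS hvT => ?_, ?_⟩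
  · have h1 : v ≠ t := by rintro rfl; exact hvT htT
    have h2 : v ≠ x := by
      rintro rfl
      have := hP.1 v hvS hvT
      linarith
    simp [h1, h2, hP.1 v hvS hvT]
  · have h3 := hP.2
    rw [Finset.sum_add_distrib, ← Finset.mul_sum, Finset.sum_sub_distrib]
    simp only [Finset.sum_ite_eq', htT, if_true]
    have : 0 ≤ ε * (1 - if x ∈ T then 1 else 0) := by
      apply mul_nonneg hε.le; split_ifs <;> norm_num
    linarith

/-- Preflow-to-flow conversion: every preflow g can be converted to a flow f
with f ≤ g pointwise and the same excess at every sink; consequently a maximum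
preflow converts to a maximum flow of the same value. -/
theorem preflow_to_flow [Fintype V]
    (c : V → V → ℝ) (hc : ∀ u v, 0 ≤ c u v)
    (S T : Finset V) (hST : Disjoint S T)
    (g : V → V → ℝ) (hg : IsPreflow c g S) :
    ∃ f : V → V → ℝ, IsPreflow c f S ∧ IsFlow c f S T ∧
      (∀ u v : V, f u v ≤ g u v) ∧
      (∀ t ∈ T, excess f t = excess g t) ∧
      ((∀ g' : V → V → ℝ, IsPreflow c g' S → flowValue g' T ≤ flowValue g T) →
        ∀ f' : V → V → ℝ, IsFlow c f' S T → flowValue f' T ≤ flowValue f T) := by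
  classical
  obtain ⟨f, h0, hle, hP, hred⟩ := exists_reduced g (fun u v => (hg.1 u v).1)
    {e | (∀ t, t ∈ T → e t = excess g t) ∧ ∀ v, v ∉ S → 0 ≤ e v}
    (by
      apply IsClosed.and
      · simp only [Set.setOf_forall]
        exact isClosed_iInter fun v => isClosed_iInter fun _ =>
          isClosed_eq (continuous_apply v) continuous_const
      · simp only [Set.setOf_forall]
        exact isClosed_iInter fun v => isClosed_iInter fun _ =>
          isClosed_le continuous_const (continuous_apply v))
    ⟨fun _ _ => rfl, hg.2⟩
  have hfe : Feasible c f := fun u v => ⟨h0 u v, (hle u v).trans (hg.1 u v).2⟩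
  refine ⟨f, ⟨hfe, hP.2⟩, ⟨hfe, ?_⟩, hle, hP.1, ?_⟩
  · intro v hvS hvT
    by_contra hne
    have hpos : 0 < excess f v := lt_of_le_of_ne (hP.2 v hvS) (Ne.symm hne)
    obtain ⟨x, hx, hneg⟩ := reach_neg f h0 v hpos
    have hxS : x ∈ S := by
      by_contra hxS
      have := hP.2 x hxS
      linarith
    have hxv : x ≠ v := by rintro rfl; linarith
    refine hred x v hxv hx (excess f v) hpos fun ε hε hεv => ⟨fun t ht => ?_, fun w hw => ?_⟩
    · have h1 : t ≠ v := by rintro rfl; exact hvT ht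
      have h2 : t ≠ x := by rintro rfl; exact Finset.disjoint_left.1 hST hxS ht
      simp [h1, h2, hP.1 t ht]
    · have h2 : w ≠ x := by rintro rfl; exact hw hxS
      by_cases h1 : w = v
      · subst h1; simp [h2, hεv]
      · simpa [h1, h2] using hP.2 w hw
  · intro hmax f' hf'
    obtain ⟨h, hh, hv⟩ := flow_dominated c S T hST f' hf'
    have e : flowValue f T = flowValue g T := Finset.sum_congr rfl hP.1
    rw [e]
    exact hv.trans (hmax h hh)
end
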